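/- Let (X,Φ) be a regular topological flow with the small flow boundary property, and let S ⊆ S' be weakly extendable cross-sections of time η > 0 such that S̄ ⊆ Int^Φ(S') and S has a small flow boundary. Then for every ε > 0 there exists a finite partition of S into weakly extendable cross-sections, each with small flow boundary and of diameter less than ε. -/

import Mathlib

open Set Filter Topology MeasureTheory

namespace FlowPaper

variable {X : Type*} [MetricSpace X]

/-- The flow `Φ` is regular when no point is fixed by the whole flow. -/
def Regular (Φ : Flow ℝ X) : Prop := ∀ x : X, ∃ t : ℝ, Φ t x ≠ x

/-- `φ_I(E) = {φ_t x : t ∈ I, x ∈ E}`. -/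
def flowSet (Φ : Flow ℝ X) (I : Set ℝ) (E : Set X) : Set X := ⋃ t ∈ I, Φ t '' E

/-- The `ζ`-cylinder `S_ζ = φ_{[-ζ,ζ]}(S)`. -/
def cyl (Φ : Flow ℝ X) (S : Set X) (ζ : ℝ) : Set X := flowSet Φ (Icc (-ζ) ζ) S

/-- `S` is a cross-section of time `η` if `Φ` is injective on `S × [-η,η]`. -/
def IsCrossSection (Φ : Flow ℝ X) (S : Set X) (η : ℝ) : Prop :=
  Set.InjOn (fun p : X × ℝ => Φ p.2 p.1) (S ×ˢ Icc (-η) η)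

/-- Weakly extendable cross-section of time `η`. -/
def IsWec (Φ : Flow ℝ X) (S : Set X) (η : ℝ) : Prop :=
  IsCrossSection Φ S η ∧ IsCrossSection Φ (closure S) η

/-- The flow interior `Int^Φ(S) = Int(S_η) ∩ S`. -/
def flowInterior (Φ : Flow ℝ X) (S : Set X) (η : ℝ) : Set X := interior (cyl Φ S η) ∩ S

/-- The flow boundary `∂^Φ S = closure S \ Int^Φ(S)`. -/
def flowBoundary (Φ : Flow ℝ X) (S : Set X) (η : ℝ) : Set X := closure S \ flowInterior Φ S η

/-- `∂^Φ S_ζ = φ_{[-ζ,ζ]}(∂^Φ S)`. -/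
def flowBoundaryCyl (Φ : Flow ℝ X) (S : Set X) (η ζ : ℝ) : Set X := cyl Φ (flowBoundary Φ S η) ζ

/-- A cross-section is global when some cylinder covers `X`. -/
def IsGlobal (Φ : Flow ℝ X) (S : Set X) : Prop := ∃ ξ > 0, cyl Φ S ξ = univ

/-- First return time `t_S(x) = inf {t > 0 : φ_t x ∈ S}`. -/
noncomputable def returnTime (Φ : Flow ℝ X) (S : Set X) (x : X) : ℝ :=
  sInf {t : ℝ | 0 < t ∧ Φ t x ∈ S}

/-- First return map `T_S(x) = φ_{t_S(x)}(x)`. -/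
noncomputable def returnMap (Φ : Flow ℝ X) (S : Set X) (x : X) : X := Φ (returnTime Φ S x) x

/-- A measure is `Φ`-invariant when it is invariant under every time `t`-map. -/
def FlowInvariant [MeasurableSpace X] (Φ : Flow ℝ X) (μ : Measure X) : Prop :=
  ∀ t : ℝ, Measure.map (Φ t) μ = μ

/-- A w.e.c. `S` of time `η` has small flow boundary when `∂^Φ S_η` is a null set. -/
def HasSmallFlowBoundary [MeasurableSpace X] (Φ : Flow ℝ X) (S : Set X) (η : ℝ) : Prop :=
  ∀ μ : Measure X, IsProbabilityMeasure μ → FlowInvariant Φ μ → μ (flowBoundaryCyl Φ S η η) = 0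

/-- The small flow boundary property of a flow. -/
def SmallFlowBoundaryProperty [MeasurableSpace X] (Φ : Flow ℝ X) : Prop :=
  ∀ x : X, ∀ S' : Set X, ∀ η : ℝ, 0 < η → IsWec Φ S' η → x ∈ flowInterior Φ S' η →
    ∃ S ⊆ S', x ∈ flowInterior Φ S η ∧ IsWec Φ S η ∧ HasSmallFlowBoundary Φ S η

/-- The frontier of `A` with respect to the topology induced on `B`. -/
def frontierIn (B A : Set X) : Set X :=
  Subtype.val '' (frontier (Subtype.val ⁻¹' A : Set B))

theorem mem_cyl {Φ : Flow ℝ X} {A : Set X} {η : ℝ} {x : X} :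
    x ∈ cyl Φ A η ↔ ∃ t ∈ Icc (-η) η, ∃ z ∈ A, Φ t z = x := by
  simp only [cyl, flowSet, mem_iUnion, mem_image, exists_prop]

theorem cyl_mono {Φ : Flow ℝ X} {A B : Set X} (h : A ⊆ B) (η : ℝ) :
    cyl Φ A η ⊆ cyl Φ B η := by
  intro x hx
  obtain ⟨t, ht, z, hz, rfl⟩ := mem_cyl.1 hx
  exact mem_cyl.2 ⟨t, ht, z, h hz, rfl⟩

theorem cyl_union (Φ : Flow ℝ X) (A B : Set X) (η : ℝ) :
    cyl Φ (A ∪ B) η = cyl Φ A η ∪ cyl Φ B η := by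
  simp only [cyl, flowSet, image_union, iUnion_union_distrib]

theorem cyl_iUnion {ι : Sort*} (Φ : Flow ℝ X) (A : ι → Set X) (η : ℝ) :
    cyl Φ (⋃ i, A i) η = ⋃ i, cyl Φ (A i) η := by
  ext x
  simp only [mem_cyl, mem_iUnion]
  tauto

theorem isCompact_cyl (Φ : Flow ℝ X) {K : Set X} (hK : IsCompact K) (η : ℝ) :
    IsCompact (cyl Φ K η) := by
  have h : cyl Φ K η = (fun p : ℝ × X => Φ p.1 p.2) '' (Icc (-η) η ×ˢ K) := by
    ext x
    simp only [mem_cyl, mem_image, mem_prod, Prod.exists]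
    grind
  rw [h]
  exact (isCompact_Icc.prod hK).image (Φ.continuous continuous_fst continuous_snd)

theorem IsCrossSection.mono {Φ : Flow ℝ X} {A B : Set X} {η : ℝ} (hB : IsCrossSection Φ B η)
    (h : A ⊆ B) : IsCrossSection Φ A η :=
  InjOn.mono (prod_mono h subset_rfl) hB

theorem IsWec.mono {Φ : Flow ℝ X} {A B : Set X} {η : ℝ} (hB : IsWec Φ B η) (h : A ⊆ B) :
    IsWec Φ A η :=
  ⟨hB.1.mono h, hB.2.mono (closure_mono h)⟩

theorem IsCrossSection.eq_of_flow_eq {Φ : Flow ℝ X} {B : Set X} {η s t : ℝ} {x y : X}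
    (hB : IsCrossSection Φ B η) (hx : x ∈ B) (hy : y ∈ B) (hs : s ∈ Icc (-η) η)
    (ht : t ∈ Icc (-η) η) (h : Φ s x = Φ t y) : x = y :=
  congrArg Prod.fst (@hB (x, s) ⟨hx, hs⟩ (y, t) ⟨hy, ht⟩ h)

theorem IsCrossSection.cyl_inter_subset {Φ : Flow ℝ X} {A B : Set X} {η : ℝ}
    (hB : IsCrossSection Φ B η) (hη : 0 ≤ η) (hA : A ⊆ B) : cyl Φ A η ∩ B ⊆ A := by
  rintro x ⟨hx, hxB⟩
  obtain ⟨t, ht, z, hz, hzx⟩ := mem_cyl.1 hx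
  have h0 : (0 : ℝ) ∈ Icc (-η) η := ⟨by linarith, hη⟩
  have : z = x := hB.eq_of_flow_eq (hA hz) hxB ht h0 (by rw [hzx, Φ.map_zero_apply])
  exact this ▸ hz

theorem IsCrossSection.flowInterior_inter {Φ : Flow ℝ X} {A B C : Set X} {η : ℝ}
    (hC : IsCrossSection Φ C η) (hA : A ⊆ C) (hB : B ⊆ C) :
    flowInterior Φ A η ∩ flowInterior Φ B η ⊆ flowInterior Φ (A ∩ B) η := by
  rintro x ⟨⟨hxA, hx⟩, hxB, hx'⟩
  refine ⟨?_, hx, hx'⟩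
  refine interior_mono (?_ : cyl Φ A η ∩ cyl Φ B η ⊆ _) (by rw [interior_inter]; exact ⟨hxA, hxB⟩)
  rintro w ⟨hwA, hwB⟩
  obtain ⟨t, ht, a, ha, rfl⟩ := mem_cyl.1 hwA
  obtain ⟨s, hs, b, hb, h⟩ := mem_cyl.1 hwB
  have hba : b = a := hC.eq_of_flow_eq (hB hb) (hA ha) hs ht h
  exact mem_cyl.2 ⟨t, ht, a, ⟨ha, hba ▸ hb⟩, rfl⟩

/-- The flow interior is local: it only depends on the section near the given point. -/
theorem IsWec.mem_flowInterior_inter [CompactSpace X] {Φ : Flow ℝ X} {A U : Set X} {η : ℝ} {x : X}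
    (hA : IsWec Φ A η) (hη : 0 ≤ η) (hx : x ∈ flowInterior Φ A η) (hU : IsOpen U) (hxU : x ∈ U) :
    x ∈ flowInterior Φ (A ∩ U) η := by
  refine ⟨?_, hx.2, hxU⟩
  have hK : IsClosed (cyl Φ (closure A \ U) η) :=
    (isCompact_cyl Φ (isClosed_closure.sdiff hU).isCompact η).isClosed
  have hxK : x ∉ cyl Φ (closure A \ U) η := fun h =>
    (hA.2.cyl_inter_subset hη sdiff_subset ⟨h, subset_closure hx.2⟩).2 hxU
  refine interior_maximal ?_ (isOpen_interior.inter hK.isOpen_compl) ⟨hx.1, hxK⟩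
  rintro w ⟨hw, hwK⟩
  obtain ⟨t, ht, a, ha, rfl⟩ := mem_cyl.1 (interior_subset hw)
  refine mem_cyl.2 ⟨t, ht, a, ⟨ha, ?_⟩, rfl⟩
  by_contra haU
  exact hwK (mem_cyl.2 ⟨t, ht, a, ⟨subset_closure ha, haU⟩, rfl⟩)

theorem IsWec.flowBoundary_inter_diff_subset [CompactSpace X] {Φ : Flow ℝ X} {S S' : Set X}
    {η : ℝ} {ι : Type*} {J : Set ι} (hJ : J.Finite) {D : ι → Set X} {i : ι}
    (hS' : IsWec Φ S' η) (hη : 0 ≤ η) (hclos : closure S ⊆ S') (hD : ∀ j, D j ⊆ S') :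
    flowBoundary Φ ((S ∩ D i) \ ⋃ j ∈ J, D j) η ⊆
      flowBoundary Φ S η ∪ ⋃ j, flowBoundary Φ (D j) η := by
  rintro y ⟨hyC, hyI⟩
  by_contra hy
  simp only [mem_union, mem_iUnion, not_or, not_exists] at hy
  have key : ∀ {A : Set X}, y ∈ closure A → y ∉ flowBoundary Φ A η → y ∈ flowInterior Φ A η :=
    fun h h' => by_contra fun h'' => h' ⟨h, h''⟩
  have hSS' : S ⊆ S' := subset_closure.trans hclos
  have hyS := key (closure_mono (sdiff_subset.trans inter_subset_left) hyC) hy.1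
  have hyD := key (closure_mono (sdiff_subset.trans inter_subset_right) hyC) (hy.2 i)
  have hyJ : ∀ j ∈ J, y ∉ closure (D j) := by
    intro j hj hyj
    obtain ⟨w, hw, hwC⟩ := mem_closure_iff.1 hyC _ isOpen_interior (key hyj (hy.2 j)).1
    exact hwC.2 (mem_biUnion hj
      (hS'.1.cyl_inter_subset hη (hD j) ⟨interior_subset hw, hSS' hwC.1.1⟩))
  have hU : IsOpen (⋃ j ∈ J, closure (D j))ᶜ :=
    (hJ.isClosed_biUnion fun _ _ => isClosed_closure).isOpen_compl
  have hyU : y ∈ (⋃ j ∈ J, closure (D j))ᶜ := by simpa using hyJ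
  have h := (hS'.mono (inter_subset_left.trans hSS')).mem_flowInterior_inter hη
    (hS'.1.flowInterior_inter hSS' (hD i) ⟨hyS, hyD⟩) hU hyU
  have hsub : S ∩ D i ∩ (⋃ j ∈ J, closure (D j))ᶜ ⊆ (S ∩ D i) \ ⋃ j ∈ J, D j :=
    inter_subset_inter_right _
      (compl_subset_compl.2 (iUnion₂_mono fun _ _ => subset_closure))
  exact hyI ⟨interior_mono (cyl_mono hsub η) h.1, hsub h.2⟩

theorem HasSmallFlowBoundary.of_subset [MeasurableSpace X] {Φ : Flow ℝ X} {A S : Set X} {η : ℝ}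
    {ι : Type*} [Countable ι] {D : ι → Set X} (hS : HasSmallFlowBoundary Φ S η)
    (hD : ∀ j, HasSmallFlowBoundary Φ (D j) η)
    (h : flowBoundary Φ A η ⊆ flowBoundary Φ S η ∪ ⋃ j, flowBoundary Φ (D j) η) :
    HasSmallFlowBoundary Φ A η := by
  intro μ hμ hinv
  refine measure_mono_null (cyl_mono h η) ?_
  rw [cyl_union, cyl_iUnion]
  exact measure_union_null (hS μ hμ hinv) (measure_iUnion_null fun j => hD j μ hμ hinv)

/-- under the small flow boundary property, a w.e.c. with small flow boundary
whose closure is contained in the flow interior of a larger w.e.c. admits finite partitions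
into w.e.c.'s with small flow boundary and arbitrarily small diameter. -/
theorem partition_small_flow_boundary {X : Type*} [MetricSpace X] [CompactSpace X]
    [MeasurableSpace X] [BorelSpace X]
    (Φ : Flow ℝ X) (hreg : Regular Φ) (hsfb : SmallFlowBoundaryProperty Φ)
    (S S' : Set X) (η : ℝ) (hη : 0 < η) (hS : IsWec Φ S η) (hS' : IsWec Φ S' η)
    (hSS' : S ⊆ S') (hclos : closure S ⊆ flowInterior Φ S' η)
    (hsmall : HasSmallFlowBoundary Φ S η) :
    ∀ ε > (0 : ℝ), ∃ (n : ℕ) (C : Fin n → Set X),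
      (∀ i j, i ≠ j → Disjoint (C i) (C j)) ∧
      (⋃ i, C i) = S ∧
      (∀ i, IsWec Φ (C i) η ∧ HasSmallFlowBoundary Φ (C i) η ∧ Metric.diam (C i) < ε) := by
  intro ε hε
  have hloc : ∀ x : closure S, ∃ D ⊆ S' ∩ Metric.ball (x : X) (ε / 3),
      (x : X) ∈ flowInterior Φ D η ∧ HasSmallFlowBoundary Φ D η := by
    intro x
    obtain ⟨D, hD, hxD, -, hsD⟩ := hsfb x (S' ∩ Metric.ball (x : X) (ε / 3)) η hη
      (hS'.mono inter_subset_left)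
      (hS'.mem_flowInterior_inter hη.le (hclos x.2) Metric.isOpen_ball
        (Metric.mem_ball_self (by positivity)))
    exact ⟨D, hD, hxD, hsD⟩
  choose E hE hxE hsE using hloc
  obtain ⟨F, hF⟩ := isClosed_closure.isCompact.elim_finite_subcover
    (fun x : closure S => interior (cyl Φ (E x) η)) (fun _ => isOpen_interior)
    (fun x hx => mem_iUnion.2 ⟨⟨x, hx⟩, (hxE ⟨x, hx⟩).1⟩)
  set e := F.equivFin
  set D : Fin F.card → Set X := fun i => E (e.symm i)
  have hDS' : ∀ i, D i ⊆ S' := fun i => (hE _).trans inter_subset_left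
  have hcover : ∀ y ∈ S, ∃ i, y ∈ D i := by
    intro y hy
    obtain ⟨x, hxF, hyx⟩ := mem_iUnion₂.1 (hF (subset_closure hy))
    refine ⟨e ⟨x, hxF⟩, hS'.1.cyl_inter_subset hη.le (hDS' _) ⟨?_, hSS' hy⟩⟩
    simpa [D] using interior_subset hyx
  refine ⟨F.card, fun i => (S ∩ D i) \ ⋃ j ∈ Iio i, D j, ?_, ?_, fun i => ⟨?_, ?_, ?_⟩⟩
  · have hlt : ∀ i j, i < j →
        Disjoint ((S ∩ D i) \ ⋃ k ∈ Iio i, D k) ((S ∩ D j) \ ⋃ k ∈ Iio j, D k) :=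
      fun i j hij => disjoint_left.2 fun y hy hy' => hy'.2 (mem_biUnion hij hy.1.2)
    intro i j hij
    rcases hij.lt_or_gt with h | h
    · exact hlt i j h
    · exact (hlt j i h).symm
  · refine subset_antisymm (iUnion_subset fun i => sdiff_subset.trans inter_subset_left) ?_
    intro y hy
    obtain ⟨i, hi, hmin⟩ := WellFounded.has_min (wellFounded_lt (α := Fin F.card))
      {i | y ∈ D i} (hcover y hy)
    refine mem_iUnion.2 ⟨i, ⟨hy, hi⟩, ?_⟩
    simp only [mem_iUnion, not_exists]
    exact fun j hj hyj => hmin j hyj hj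
  · exact hS.mono (sdiff_subset.trans inter_subset_left)
  · exact HasSmallFlowBoundary.of_subset hsmall (fun j => hsE _)
      (hS'.flowBoundary_inter_diff_subset (toFinite _) hη.le
        (hclos.trans inter_subset_right) hDS')
  · have hsub : (S ∩ D i) \ ⋃ j ∈ Iio i, D j ⊆ Metric.ball (e.symm i : closure S).1 (ε / 3) :=
      fun y hy => (hE _ hy.1.2).2
    calc Metric.diam _ ≤ Metric.diam (Metric.ball (e.symm i : closure S).1 (ε / 3)) :=
          Metric.diam_mono hsub Metric.isBounded_ball
      _ ≤ 2 * (ε / 3) := Metric.diam_ball (by positivity)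
      _ < ε := by linarith

end FlowPaper
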